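/- Let V be a finite-dimensional real normed vector space with a direct sum decomposition V = E ⊕ F into closed complementary subspaces, with projections π_E (onto E along F) and π_F (onto F along E). Let φ : E → F and ψ : F → E be Lipschitz maps with Lip(φ) · Lip(ψ) < 1. Then there is a constant κ > 0, depending only on Lip(φ), Lip(ψ), ‖π_E‖ and ‖π_F‖, such that for every x ∈ G_φ = { u + φ(u) : u ∈ E } and every y ∈ G_ψ = { ψ(v) + v : v ∈ F }, the unique intersection point z of G_φ and G_ψ satisfies ‖z − x‖ ≤ κ ‖x − y‖. In particular, if ‖x − y‖ < δ then the intersection point lies in the ball of radius κδ around x. -/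

import Mathlib

/-- In the linear model of transverse Lipschitz graphs, the
intersection point of the graphs `G_φ` and `G_ψ` through `x ∈ G_φ` and
`y ∈ G_ψ` lies at distance at most `κ‖x - y‖` from `x`, where `κ` depends only
on (bounds for) `Lip(φ)`, `Lip(ψ)`, `‖π_E‖` and `‖π_F‖`. -/
theorem graph_intersection_distance_bound
    (Kφ Kψ PE PF : NNReal) (hK : (Kφ : ℝ) * (Kψ : ℝ) < 1) :
    ∃ κ : ℝ, 0 < κ ∧
      ∀ (V : Type) [NormedAddCommGroup V], ∀ [NormedSpace ℝ V],
      ∀ [FiniteDimensional ℝ V],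
      ∀ (E F : Submodule ℝ V), IsCompl E F →
      ∀ (πE πF : V →L[ℝ] V),
        -- `πE` is the projection onto `E` along `F`, `πF` the one onto `F` along `E`
        (∀ w : V, πE w ∈ E) → (∀ u : E, πE u = u) → (∀ v : F, πE v = 0) →
        (∀ w : V, πF w ∈ F) → (∀ v : F, πF v = v) → (∀ u : E, πF u = 0) →
        ‖πE‖ ≤ (PE : ℝ) → ‖πF‖ ≤ (PF : ℝ) →
      ∀ (φ : E → F) (ψ : F → E),
        LipschitzWith Kφ φ → LipschitzWith Kψ ψ →
        ∀ x y z : V,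
          x ∈ {w : V | ∃ u : E, w = (u : V) + (φ u : V)} →
          y ∈ {w : V | ∃ v : F, w = (ψ v : V) + (v : V)} →
          z ∈ {w : V | ∃ u : E, w = (u : V) + (φ u : V)} →
          z ∈ {w : V | ∃ v : F, w = (ψ v : V) + (v : V)} →
          ‖z - x‖ ≤ κ * ‖x - y‖ := by
  have h1 : 0 < 1 - (Kφ : ℝ) * (Kψ : ℝ) := by linarith
  refine ⟨(1 + Kφ) * ((Kψ * PF + PE) / (1 - (Kφ : ℝ) * (Kψ : ℝ))) + 1, by positivity, ?_⟩
  intro V _ _ _ E F hEF πE πF _ hE1 hE2 _ hF1 hF2 hPE hPF φ ψ hφ hψ x y z hx hy hz hz'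
  obtain ⟨u, hu⟩ := hx
  obtain ⟨v, hv⟩ := hy
  obtain ⟨a, ha⟩ := hz
  obtain ⟨b, hb⟩ := hz'
  have hab : a = ψ b := by
    have h := congrArg πE (ha.symm.trans hb)
    simp only [map_add, hE1, hE2, add_zero] at h
    exact Subtype.ext h
  have hba : φ a = b := by
    have h := congrArg πF (ha.symm.trans hb)
    simp only [map_add, hF1, hF2, zero_add] at h
    exact Subtype.ext h
  have hEd : ‖ψ v - u‖ ≤ PE * ‖x - y‖ := by
    have h : πE (x - y) = (u : V) - ψ v := by
      rw [hu, hv]; simp only [map_sub, map_add, hE1, hE2, add_zero]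
    have h2 := πE.le_of_opNorm_le hPE (x - y)
    rw [h] at h2
    rw [norm_sub_rev]
    exact h2
  have hFd : ‖φ u - v‖ ≤ PF * ‖x - y‖ := by
    have h : πF (x - y) = (φ u : V) - v := by
      rw [hu, hv]; simp only [map_sub, map_add, hF1, hF2, zero_add]
    have h2 := πF.le_of_opNorm_le hPF (x - y)
    rw [h] at h2
    exact h2
  have hA : ‖a - u‖ ≤ Kψ * ‖b - v‖ + PE * ‖x - y‖ := by
    have h := hψ.norm_sub_le b v
    have h2 := norm_sub_le_norm_sub_add_norm_sub (ψ b) (ψ v) u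
    rw [← hab] at h h2
    linarith
  have hφa := hφ.norm_sub_le a u
  have hB : ‖b - v‖ ≤ Kφ * ‖a - u‖ + PF * ‖x - y‖ := by
    have h2 := norm_sub_le_norm_sub_add_norm_sub (φ a) (φ u) v
    rw [hba] at h2
    rw [hba] at hφa
    linarith
  have hA2 : ‖a - u‖ ≤ (Kψ * PF + PE) / (1 - (Kφ : ℝ) * (Kψ : ℝ)) * ‖x - y‖ := by
    rw [div_mul_eq_mul_div, le_div_iff₀ h1]
    have := mul_le_mul_of_nonneg_left hB Kψ.coe_nonneg
    linarith
  have hzx : ‖z - x‖ ≤ ‖a - u‖ + ‖φ a - φ u‖ := by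
    have h : z - x = ((a - u : E) : V) + ((φ a - φ u : F) : V) := by
      rw [ha, hu]; push_cast; abel
    rw [h]
    exact norm_add_le _ _
  have h3 := mul_le_mul_of_nonneg_left hA2 (by positivity : (0 : ℝ) ≤ 1 + Kφ)
  have h4 := norm_nonneg (x - y)
  linarith
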